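/- The canonical bijection φ : Zar(KR(R,b)) → Zar_h(R), sending a valuation subring W of K(X) containing KR(R,b) to the subring ⊕_{α∈⟨Γ⟩}(W ∩ (R_H)_α) of K (the set of all finite sums of homogeneous elements of R_H lying in W), is a homeomorphism when Zar(KR(R,b)) and Zar_h(R) are endowed with their Zariski topologies. -/

import Mathlib

open Pointwise

section
/- `Γ` is a nonzero torsionless (i.e. admitting a compatible total order) cancellative
commutative monoid, `A` is an integral domain graded by `Γ` via `𝒜`, with quotient
field `K`. -/
variable {Γ : Type*} [AddCommMonoid Γ] [LinearOrder Γ]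
  [CovariantClass Γ Γ (· + ·) (· < ·)] [Nontrivial Γ]
variable {A : Type*} [CommRing A] [IsDomain A]
variable {K : Type*} [Field K] [Algebra A K] [IsFractionRing A K]

instance : SMulCommClass K A K := SMulCommClass.symm A K K

variable (𝒜 : Γ → AddSubgroup A) [GradedRing 𝒜]

/-- `a` is a nonzero homogeneous element of the graded domain `A`. -/
def IsHomog (a : A) : Prop := a ≠ 0 ∧ ∃ γ : Γ, a ∈ 𝒜 γ

/-- `x ∈ K` is a (nonzero) homogeneous element of the homogeneous quotient ring `R_H`,
i.e. `x = a/s` with `a` a nonzero homogeneous element and `s ∈ H`. -/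
def IsHomogElem (x : K) : Prop :=
  ∃ a s : A, IsHomog 𝒜 a ∧ IsHomog 𝒜 s ∧ x * algebraMap A K s = algebraMap A K a

/-- `x ∈ K` belongs to the homogeneous quotient ring `R_H`. -/
def MemRH (x : K) : Prop :=
  ∃ a s : A, IsHomog 𝒜 s ∧ x * algebraMap A K s = algebraMap A K a

/-- The image in `K` of an integral ideal of `A`. -/
def idealToK (I : Ideal A) : Submodule A K := Submodule.map (Algebra.linearMap A K) I

/-- `E` is a homogeneous fractional ideal of `A`: `sE` is (the image in `K` of) a
homogeneous integral ideal for some nonzero homogeneous `s`. -/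
def IsHomogFrac (E : Submodule A K) : Prop :=
  ∃ s : A, IsHomog 𝒜 s ∧ ∃ I : Ideal A, Ideal.IsHomogeneous 𝒜 I ∧
    algebraMap A K s • E = idealToK (K := K) I

/-- The four axioms of a semistar operation, imposed on nonzero `A`-submodules of `K`. -/
def IsSemistar (star : Submodule A K → Submodule A K) : Prop :=
  (∀ x : K, x ≠ 0 → ∀ E : Submodule A K, E ≠ ⊥ → star (x • E) = x • star E) ∧
  (∀ E F : Submodule A K, E ≠ ⊥ → E ≤ F → star E ≤ star F) ∧
  (∀ E : Submodule A K, E ≠ ⊥ → E ≤ star E) ∧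
  (∀ E : Submodule A K, E ≠ ⊥ → star (star E) = star E)

/-- `star` is homogeneous preserving. -/
def HomogPres (star : Submodule A K → Submodule A K) : Prop :=
  ∀ E : Submodule A K, E ≠ ⊥ → IsHomogFrac 𝒜 E → IsHomogFrac 𝒜 (star E)

/-- Membership in `E^{⋆_f} = ⋃ {F^⋆ : F nonzero finitely generated, F ⊆ E}`. -/
def MemStarF (star : Submodule A K → Submodule A K) (E : Submodule A K) (x : K) : Prop :=
  ∃ F : Submodule A K, F ≠ ⊥ ∧ F.FG ∧ F ≤ E ∧ x ∈ star F

/-- `star` is of finite type, i.e. `⋆ = ⋆_f`. -/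
def IsFiniteType (star : Submodule A K → Submodule A K) : Prop :=
  ∀ E : Submodule A K, E ≠ ⊥ → ∀ x : K, x ∈ star E ↔ MemStarF star E x

/-- Membership in `E^{⋆_a}`:  `F^{⋆_a} = ⋃ {((FG)^⋆ : G^⋆) : G nonzero f.g.}` for f.g. `F`,
and `E^{⋆_a} = ⋃ {F^{⋆_a} : F ⊆ E nonzero f.g.}`. -/
def MemStarA (star : Submodule A K → Submodule A K) (E : Submodule A K) (x : K) : Prop :=
  ∃ F : Submodule A K, F ≠ ⊥ ∧ F.FG ∧ F ≤ E ∧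
    ∃ G : Submodule A K, G ≠ ⊥ ∧ G.FG ∧ ∀ y ∈ star G, x * y ∈ star (F * G)

/-- Membership in `E^{⋆_{a(h)}}`: as in `⋆_a` but with `G` ranging over nonzero finitely
generated *homogeneous* fractional ideals. -/
def MemStarAH (star : Submodule A K → Submodule A K) (E : Submodule A K) (x : K) : Prop :=
  ∃ F : Submodule A K, F ≠ ⊥ ∧ F.FG ∧ F ≤ E ∧
    ∃ G : Submodule A K, G ≠ ⊥ ∧ G.FG ∧ IsHomogFrac 𝒜 G ∧ ∀ y ∈ star G, x * y ∈ star (F * G)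

/-- `star` is graded-e.a.b. -/
def IsGrEab (star : Submodule A K → Submodule A K) : Prop :=
  ∀ E F G : Submodule A K,
    E ≠ ⊥ → E.FG → IsHomogFrac 𝒜 E →
    F ≠ ⊥ → F.FG → IsHomogFrac 𝒜 F →
    G ≠ ⊥ → G.FG → IsHomogFrac 𝒜 G →
    star (E * F) ≤ star (E * G) → star F ≤ star G

/-- The `A`-submodule of `K` generated by all products `e * v`, `e ∈ E`, `v ∈ S`
(e.g. `EV` for an overring `V`). -/
def mulSet (E : Submodule A K) (S : Set K) : Submodule A K :=
  Submodule.span A {z : K | ∃ e ∈ E, ∃ v ∈ S, z = e * v}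

/-- The `b`-operation: `E^b = ⋂ {EV : V a valuation overring of A}`. -/
def bOp : Submodule A K → Submodule A K := fun E =>
  ⨅ (V : ValuationSubring K) (_ : ∀ a : A, algebraMap A K a ∈ V), mulSet E (V : Set K)

/-- The image of a polynomial over `A` in the rational function field `K(X)`. -/
noncomputable def polyToRatFunc (f : Polynomial A) : RatFunc K :=
  algebraMap (Polynomial K) (RatFunc K) (Polynomial.map (algebraMap A K) f)

/-- The content ideal `c(f)` of a polynomial. -/
def contentIdeal (f : Polynomial A) : Ideal A := Ideal.span (Set.range f.coeff)

/-- The homogeneous content ideal `𝒜_f`, generated by all homogeneous components of all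
coefficients of `f`. -/
def homogContentIdeal (f : Polynomial A) : Ideal A :=
  Ideal.span {a : A | ∃ (n : ℕ) (γ : Γ), a = (DirectSum.decompose 𝒜 (f.coeff n) γ : A)}

/-- The Kronecker function ring `Kr(R,⋆)` as a subset of `K(X)`. -/
def KrSet (star : Submodule A K → Submodule A K) : Set (RatFunc K) :=
  {q | ∃ f g h : Polynomial A, g ≠ 0 ∧ h ≠ 0 ∧
    q * polyToRatFunc (K := K) g = polyToRatFunc (K := K) f ∧
    idealToK (contentIdeal f * contentIdeal h) ≤ star (idealToK (contentIdeal g * contentIdeal h))}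

/-- The homogeneous Kronecker function ring `KR(R,⋆)` as a subset of `K(X)`. -/
def KRSet (star : Submodule A K → Submodule A K) : Set (RatFunc K) :=
  {q | ∃ f g h : Polynomial A, g ≠ 0 ∧ h ≠ 0 ∧
    q * polyToRatFunc (K := K) g = polyToRatFunc (K := K) f ∧
    idealToK (homogContentIdeal 𝒜 f * homogContentIdeal 𝒜 h) ≤
      star (idealToK (homogContentIdeal 𝒜 g * homogContentIdeal 𝒜 h))}

/-- `V` is a homogeneous overring of `A`: `R ⊆ V ⊆ R_H` and `V` is generated as an
additive group by its homogeneous elements. -/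
def IsHomogOverring (V : Subring K) : Prop :=
  (∀ a : A, algebraMap A K a ∈ V) ∧ (∀ x ∈ V, MemRH 𝒜 x) ∧
  (∀ v ∈ V, v ∈ AddSubgroup.closure {x : K | x ∈ V ∧ IsHomogElem 𝒜 x})

/-- `V` is a gr-valuation overring of `A`. -/
def IsGrValOverring (V : Subring K) : Prop :=
  IsHomogOverring 𝒜 V ∧ ∀ x : K, IsHomogElem 𝒜 x → x ∈ V ∨ x⁻¹ ∈ V

/-- `V` is a gr-`⋆`-valuation overring of `A`: `F^⋆ ⊆ FV` for every nonzero finitely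
generated homogeneous fractional ideal `F`. -/
def IsGrStarValOverring (star : Submodule A K → Submodule A K) (V : Subring K) : Prop :=
  ∀ F : Submodule A K, F ≠ ⊥ → F.FG → IsHomogFrac 𝒜 F → star F ≤ mulSet F (V : Set K)

end

section ZarSpaces
variable {Γ : Type*} [AddCommMonoid Γ] [LinearOrder Γ]
  [CovariantClass Γ Γ (· + ·) (· < ·)] [Nontrivial Γ]
  {A : Type*} [CommRing A] [IsDomain A]
  (K : Type*) [Field K] [Algebra A K] [IsFractionRing A K]
  (𝒜 : Γ → AddSubgroup A) [GradedRing 𝒜]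

/-- `Zar_h(R)`: the set of gr-valuation overrings of `R`. -/
abbrev ZarH := {V : Subring K // IsGrValOverring 𝒜 V}

/-- The Zariski topology on `Zar_h(R)`, with subbasic open sets `{V : u ∈ V}` for `u`
a homogeneous element of `R_H`. -/
instance : TopologicalSpace (ZarH K 𝒜) :=
  TopologicalSpace.generateFrom
    {S : Set (ZarH K 𝒜) | ∃ u : K, IsHomogElem 𝒜 u ∧ S = {V | u ∈ V.1}}

/-- `Zar(KR(R,b))`: the set of valuation overrings (inside `K(X)`) of the homogeneous
Kronecker function ring of `R` with respect to the `b`-operation. -/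
abbrev ZarKRb :=
  {W : ValuationSubring (RatFunc K) //
    KRSet 𝒜 (bOp : Submodule A K → Submodule A K) ⊆ (W : Set (RatFunc K))}

/-- The Zariski topology on `Zar(KR(R,b))`, with subbasic open sets `{W : q ∈ W}`
for `q ∈ K(X)`. -/
instance : TopologicalSpace (ZarKRb K 𝒜) :=
  TopologicalSpace.generateFrom
    {S : Set (ZarKRb K 𝒜) | ∃ q : RatFunc K, S = {W | q ∈ W.1}}

end ZarSpaces

/-- The coefficientwise maximum of a valuation. -/
noncomputable def gaussValue {R M Γ₀ : Type*} [CommRing R]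
    [LinearOrderedCommGroupWithZero Γ₀] (v : Valuation R Γ₀) (f : AddMonoidAlgebra R M) : Γ₀ :=
  f.coeff.support.sup fun m => v (f.coeff m)

section Gauss
variable {R M Γ₀ : Type*} [CommRing R]
    [LinearOrderedCommGroupWithZero Γ₀] (v : Valuation R Γ₀) 

theorem gaussValue_le_iff (f : AddMonoidAlgebra R M) (c : Γ₀) :
    gaussValue v f ≤ c ↔ ∀ m, v (f.coeff m) ≤ c := by
  rw [gaussValue, Finset.sup_le_iff]
  refine ⟨fun h m => ?_, fun h m _ => h m⟩
  by_cases hm : f.coeff m = 0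
  · simp [hm]
  · exact h m (Finsupp.mem_support_iff.2 hm)

theorem le_gaussValue (f : AddMonoidAlgebra R M) (m : M) : v (f.coeff m) ≤ gaussValue v f :=
  (gaussValue_le_iff v f _).1 le_rfl m

theorem exists_eq_gaussValue (f : AddMonoidAlgebra R M) (hf : gaussValue v f ≠ 0) :
    ∃ m ∈ f.coeff.support, v (f.coeff m) = gaussValue v f := by
  obtain ⟨m, hm, h⟩ := Finset.exists_mem_eq_sup f.coeff.support
    (Finset.nonempty_iff_ne_empty.2 fun h => hf (by simp [gaussValue, h, bot_eq_zero])) fun m => v (f.coeff m)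
  exact ⟨m, hm, h.symm⟩

theorem gaussValue_mul [Add M] [UniqueSums M] (f g : AddMonoidAlgebra R M) :
    gaussValue v (f * g) = gaussValue v f * gaussValue v g := by
  classical
  apply le_antisymm
  · rw [gaussValue_le_iff]
    intro m
    rw [AddMonoidAlgebra.coeff_mul]
    refine v.map_sum_le fun a _ => v.map_sum_le fun b _ => ?_
    beta_reduce
    split_ifs
    · rw [map_mul]
      exact mul_le_mul' (le_gaussValue v f a) (le_gaussValue v g b)
    · simp
  · by_cases hf : gaussValue v f = 0
    · simp [hf]
    by_cases hg : gaussValue v g = 0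
    · simp [hg]
    obtain ⟨m, hm, hfm⟩ := exists_eq_gaussValue v f hf
    obtain ⟨n, hn, hgn⟩ := exists_eq_gaussValue v g hg
    obtain ⟨a, ha, b, hb, hab⟩ := UniqueSums.uniqueAdd_of_nonempty
      (A := {x ∈ f.coeff.support | v (f.coeff x) = gaussValue v f})
      (B := {x ∈ g.coeff.support | v (g.coeff x) = gaussValue v g})
      ⟨m, by simp_all⟩ ⟨n, by simp_all⟩
    rw [Finset.mem_filter] at ha hb
    refine le_trans (le_of_eq ?_) (le_gaussValue v (f * g) (a + b))
    have hprod : (f * g).coeff (a + b) = ∑ p ∈ f.coeff.support ×ˢ g.coeff.support,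
        if p.1 + p.2 = a + b then f.coeff p.1 * g.coeff p.2 else 0 := by
      rw [AddMonoidAlgebra.coeff_mul, Finset.sum_product]
      rfl
    rw [hprod, ← Finset.add_sum_erase _ _ (Finset.mk_mem_product ha.1 hb.1), if_pos rfl,
      v.map_add_eq_of_lt_left, map_mul, ha.2, hb.2]
    rw [map_mul, ha.2, hb.2]
    refine v.map_sum_lt (mul_ne_zero hf hg) fun p hp => ?_
    rw [Finset.mem_erase, Finset.mem_product] at hp
    split_ifs with hp'
    · rw [map_mul]
      rcases (le_gaussValue v f p.1).lt_or_eq with h1 | h1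
      · exact mul_lt_mul_of_lt_of_le_of_nonneg_of_pos h1 (le_gaussValue v g p.2) zero_le (zero_lt_iff.2 hg)
      rcases (le_gaussValue v g p.2).lt_or_eq with h2 | h2
      · exact mul_lt_mul_of_le_of_lt_of_nonneg_of_pos h1.le h2 zero_le (zero_lt_iff.2 hf)
      · exact absurd (hab (Finset.mem_filter.2 ⟨hp.2.1, h1⟩) (Finset.mem_filter.2 ⟨hp.2.2, h2⟩) hp')
          fun h => hp.1 (Prod.ext h.1 h.2)
    · rw [map_zero]
      exact zero_lt_iff.2 (mul_ne_zero hf hg)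

/-- The Gauss extension of a valuation to a monoid algebra with unique sums. -/
noncomputable def gaussValuation [AddCommMonoid M] [UniqueSums M] :
    Valuation (AddMonoidAlgebra R M) Γ₀ where
  toFun := gaussValue v
  map_zero' := by simp [gaussValue, bot_eq_zero]
  map_one' := by
    classical
    apply le_antisymm
    · rw [gaussValue_le_iff]
      intro m
      rw [AddMonoidAlgebra.one_def, AddMonoidAlgebra.coeff_single, Finsupp.single_apply]
      split_ifs <;> simp
    · simpa [AddMonoidAlgebra.one_def] using le_gaussValue v (1 : AddMonoidAlgebra R M) 0
  map_mul' := gaussValue_mul v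
  map_add_le_max' f g := by
    rw [gaussValue_le_iff]
    intro m
    rw [AddMonoidAlgebra.coeff_add, Finsupp.add_apply]
    exact (v.map_add _ _).trans (max_le_max (le_gaussValue v f m) (le_gaussValue v g m))

end Gauss

theorem uniqueSums_of_covariantClass_lt (Γ : Type*) [AddCommMonoid Γ] [LinearOrder Γ]
    [CovariantClass Γ Γ (· + ·) (· < ·)] : UniqueSums Γ := by
  have : IsLeftCancelAdd Γ := ⟨fun a b c h => by
    rcases lt_trichotomy b c with hbc | hbc | hbc
    · exact absurd h (add_lt_add_right hbc a).ne
    · exact hbc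
    · exact absurd h (add_lt_add_right hbc a).ne'⟩
  infer_instance
section Homogeneous
variable {Γ : Type*} {A : Type*} [CommRing A]
  {K : Type*} [Field K] [Algebra A K] {𝒜 : Γ → AddSubgroup A}

theorem IsHomog.algebraMap_ne_zero (K : Type*) [Field K] [Algebra A K] [IsFractionRing A K]
    {a : A} (ha : IsHomog 𝒜 a) : algebraMap A K a ≠ 0 :=
  (map_ne_zero_iff _ (IsFractionRing.injective A K)).2 ha.1

theorem IsHomog.neg {a : A} (ha : IsHomog 𝒜 a) : IsHomog 𝒜 (-a) :=
  ⟨neg_ne_zero.2 ha.1, ha.2.imp fun _ h => neg_mem h⟩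

theorem IsHomogElem.neg {x : K} (hx : IsHomogElem 𝒜 x) : IsHomogElem 𝒜 (-x) := by
  obtain ⟨a, s, ha, hs, h⟩ := hx
  exact ⟨-a, s, ha.neg, hs, by rw [neg_mul, h, map_neg]⟩

variable [IsFractionRing A K]

theorem isHomogElem_iff_eq_div {x : K} :
    IsHomogElem 𝒜 x ↔ ∃ a s : A, IsHomog 𝒜 a ∧ IsHomog 𝒜 s ∧
      x = algebraMap A K a / algebraMap A K s := by
  refine exists_congr fun a => exists_congr fun s => and_congr_right fun _ =>
    and_congr_right fun hs => ?_
  rw [eq_div_iff (hs.algebraMap_ne_zero K)]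

theorem IsHomog.isHomogElem_div {a s : A} (ha : IsHomog 𝒜 a) (hs : IsHomog 𝒜 s) :
    IsHomogElem 𝒜 (algebraMap A K a / algebraMap A K s) :=
  isHomogElem_iff_eq_div.2 ⟨a, s, ha, hs, rfl⟩

theorem IsHomogElem.ne_zero {x : K} (hx : IsHomogElem 𝒜 x) : x ≠ 0 := by
  obtain ⟨a, s, ha, hs, rfl⟩ := isHomogElem_iff_eq_div.1 hx
  exact div_ne_zero (ha.algebraMap_ne_zero K) (hs.algebraMap_ne_zero K)

theorem IsHomogElem.inv {x : K} (hx : IsHomogElem 𝒜 x) : IsHomogElem 𝒜 x⁻¹ := by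
  obtain ⟨a, s, ha, hs, rfl⟩ := isHomogElem_iff_eq_div.1 hx
  rw [inv_div]
  exact hs.isHomogElem_div ha

end Homogeneous

section HomogeneousMul
variable {Γ : Type*} [AddCommMonoid Γ] [LinearOrder Γ] {A : Type*} [CommRing A]
  {K : Type*} [Field K] [Algebra A K] {𝒜 : Γ → AddSubgroup A} [GradedRing 𝒜]

theorem algebraMap_mem_of_isHomog_mem (S : AddSubmonoid K)
    (h : ∀ a : A, IsHomog 𝒜 a → algebraMap A K a ∈ S) (a : A) : algebraMap A K a ∈ S := by
  classical
  rw [← DirectSum.sum_support_decompose 𝒜 a, map_sum]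
  refine sum_mem fun γ hγ => h _ ⟨?_, γ, SetLike.coe_mem _⟩
  simpa using hγ

variable [IsDomain A]

theorem IsHomog.mul {a b : A} (ha : IsHomog 𝒜 a) (hb : IsHomog 𝒜 b) : IsHomog 𝒜 (a * b) := by
  obtain ⟨ha0, γ, hγ⟩ := ha
  obtain ⟨hb0, δ, hδ⟩ := hb
  exact ⟨mul_ne_zero ha0 hb0, γ + δ, SetLike.mul_mem_graded hγ hδ⟩

theorem isHomog_one : IsHomog 𝒜 (1 : A) :=
  ⟨one_ne_zero, 0, SetLike.one_mem_graded 𝒜⟩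

theorem IsHomog.isHomogElem {a : A} (ha : IsHomog 𝒜 a) : IsHomogElem 𝒜 (algebraMap A K a) :=
  ⟨a, 1, ha, isHomog_one, by simp⟩

theorem IsHomogElem.mul {x y : K} (hx : IsHomogElem 𝒜 x) (hy : IsHomogElem 𝒜 y) :
    IsHomogElem 𝒜 (x * y) := by
  obtain ⟨a, s, ha, hs, h⟩ := hx
  obtain ⟨b, t, hb, ht, h'⟩ := hy
  exact ⟨a * b, s * t, ha.mul hb, hs.mul ht, by rw [map_mul, map_mul, ← h, ← h']; ring⟩

theorem MemRH.add {x y : K} (hx : MemRH 𝒜 x) (hy : MemRH 𝒜 y) : MemRH 𝒜 (x + y) := by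
  obtain ⟨a, s, hs, h⟩ := hx
  obtain ⟨b, t, ht, h'⟩ := hy
  refine ⟨a * t + b * s, s * t, hs.mul ht, ?_⟩
  rw [map_add, map_mul, map_mul, map_mul, ← h, ← h']
  ring

end HomogeneousMul

section Components
variable {Γ : Type*} [AddCommMonoid Γ] [LinearOrder Γ] {A : Type*} [CommRing A]
  {𝒜 : Γ → AddSubgroup A} [GradedRing 𝒜]

variable (𝒜) in
/-- The set of homogeneous components of the coefficients of `f`. -/
def homogComponents (f : Polynomial A) : Set A :=
  {a : A | ∃ (n : ℕ) (γ : Γ), a = (DirectSum.decompose 𝒜 (f.coeff n) γ : A)}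

theorem homogContentIdeal_eq_span (f : Polynomial A) :
    homogContentIdeal 𝒜 f = Ideal.span (homogComponents 𝒜 f) := rfl

theorem finite_homogComponents (f : Polynomial A) : (homogComponents 𝒜 f).Finite := by
  classical
  refine ((f.support.finite_toSet.biUnion fun n _ =>
    ((DirectSum.decompose 𝒜 (f.coeff n)).support.finite_toSet.image
      fun γ => (DirectSum.decompose 𝒜 (f.coeff n) γ : A))).insert 0).subset ?_
  rintro _ ⟨n, γ, rfl⟩
  by_cases hγ : DirectSum.decompose 𝒜 (f.coeff n) γ = 0
  · simp [hγ]
  · refine Or.inr (Set.mem_biUnion (x := n) ?_ ⟨γ, by simpa using hγ, rfl⟩)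
    rw [Finset.mem_coe, Polynomial.mem_support_iff]
    intro h0
    simp [h0] at hγ

theorem isHomog_of_mem_homogComponents {f : Polynomial A} {c : A}
    (hc : c ∈ homogComponents 𝒜 f) (hc0 : c ≠ 0) : IsHomog 𝒜 c := by
  obtain ⟨n, γ, rfl⟩ := hc
  exact ⟨hc0, γ, SetLike.coe_mem _⟩

theorem eq_zero_or_eq_of_mem_homogComponents_C {a c : A} {γ : Γ} (ha : a ∈ 𝒜 γ)
    (hc : c ∈ homogComponents 𝒜 (Polynomial.C a)) : c = 0 ∨ c = a := by
  obtain ⟨n, δ, rfl⟩ := hc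
  rw [Polynomial.coeff_C]
  split_ifs with hn
  · by_cases h : γ = δ
    · subst h
      exact Or.inr (DirectSum.decompose_of_mem_same 𝒜 ha)
    · exact Or.inl (DirectSum.decompose_of_mem_ne 𝒜 ha h)
  · simp

theorem mem_homogComponents_C {a : A} {γ : Γ} (ha : a ∈ 𝒜 γ) :
    a ∈ homogComponents 𝒜 (Polynomial.C a) :=
  ⟨0, γ, by rw [Polynomial.coeff_C_zero, DirectSum.decompose_of_mem_same 𝒜 ha]⟩

/-- A supremum over the homogeneous components of a polynomial is attained. -/
theorem exists_mem_homogComponents_eq {Γ₀ : Type*} [LinearOrder Γ₀] (f : Polynomial A)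
    (v : A → Γ₀) (x : Γ₀) (h : ∀ b, x ≤ b ↔ ∀ c ∈ homogComponents 𝒜 f, v c ≤ b) :
    ∃ c ∈ homogComponents 𝒜 f, x = v c := by
  obtain ⟨c, hc, hmax⟩ := Set.exists_max_image (homogComponents 𝒜 f) v
    (finite_homogComponents f) ⟨_, 0, 0, rfl⟩
  exact ⟨c, hc, le_antisymm ((h _).2 hmax) ((h _).1 le_rfl c hc)⟩

theorem homogContentIdeal_one : homogContentIdeal 𝒜 (1 : Polynomial A) = ⊤ := by
  rw [Ideal.eq_top_iff_one, homogContentIdeal_eq_span, ← Polynomial.C_1]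
  exact Ideal.subset_span (mem_homogComponents_C (SetLike.one_mem_graded 𝒜))

theorem homogContentIdeal_C_le {f : Polynomial A} {c : A} (hc : c ∈ homogComponents 𝒜 f) :
    homogContentIdeal 𝒜 (Polynomial.C c) ≤ homogContentIdeal 𝒜 f := by
  obtain ⟨n, γ, rfl⟩ := id hc
  rw [homogContentIdeal_eq_span, Ideal.span_le]
  intro d hd
  rcases eq_zero_or_eq_of_mem_homogComponents_C (SetLike.coe_mem _) hd with rfl | rfl
  · exact zero_mem _
  · exact Ideal.subset_span hc

end Components

section Kronecker
variable {A : Type*} [CommRing A] {K : Type*} [Field K] [Algebra A K]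

theorem le_bOp (E : Submodule A K) : E ≤ bOp E := 
  le_iInf₂ fun V _ x hx => Submodule.subset_span ⟨x, hx, 1, V.one_mem, by simp⟩

variable (A K) in
/-- `polyToRatFunc` as a ring homomorphism. -/
noncomputable def polyToRatFuncHom : Polynomial A →+* RatFunc K :=
  (algebraMap (Polynomial K) (RatFunc K)).comp (Polynomial.mapRingHom (algebraMap A K))

theorem polyToRatFuncHom_apply (f : Polynomial A) :
    polyToRatFuncHom A K f = polyToRatFunc f := rfl

theorem polyToRatFuncHom_C (a : A) :
    polyToRatFuncHom A K (Polynomial.C a) = algebraMap K (RatFunc K) (algebraMap A K a) := by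
  simp [polyToRatFuncHom, RatFunc.algebraMap_eq_C]

variable [IsFractionRing A K]

theorem polyToRatFuncHom_injective : Function.Injective (polyToRatFuncHom A K) :=
  (IsFractionRing.injective (Polynomial K) (RatFunc K)).comp
    (Polynomial.map_injective _ (IsFractionRing.injective A K))

variable [IsDomain A]

theorem exists_mul_polyToRatFuncHom_eq (q : RatFunc K) :
    ∃ f g : Polynomial A, g ≠ 0 ∧ q * polyToRatFuncHom A K g = polyToRatFuncHom A K f := by
  obtain ⟨b, hb, hf⟩ := IsLocalization.integerNormalization_spec (nonZeroDivisors A) q.num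
  obtain ⟨c, hc, hg⟩ := IsLocalization.integerNormalization_spec (nonZeroDivisors A) q.denom
  set f := IsLocalization.integerNormalization (nonZeroDivisors A) q.num
  set g := IsLocalization.integerNormalization (nonZeroDivisors A) q.denom
  have hinj := IsFractionRing.injective A K
  have hb0 := nonZeroDivisors.ne_zero hb
  have hc0 := nonZeroDivisors.ne_zero hc
  have hq : algebraMap (Polynomial K) (RatFunc K) q.denom ≠ 0 := by
    simpa using q.denom_ne_zero
  have hf' : polyToRatFuncHom A K f =
      polyToRatFuncHom A K (Polynomial.C b) * algebraMap _ _ q.num := by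
    rw [polyToRatFuncHom_apply, polyToRatFunc, hf, ← algebraMap_smul K b, Polynomial.smul_eq_C_mul,
      map_mul]
    simp [polyToRatFuncHom]
  have hg' : polyToRatFuncHom A K g =
      polyToRatFuncHom A K (Polynomial.C c) * algebraMap _ _ q.denom := by
    rw [polyToRatFuncHom_apply, polyToRatFunc, hg, ← algebraMap_smul K c, Polynomial.smul_eq_C_mul,
      map_mul]
    simp [polyToRatFuncHom]
  refine ⟨Polynomial.C c * f, Polynomial.C b * g, ?_, ?_⟩
  · rw [← (map_ne_zero_iff _ (polyToRatFuncHom_injective (K := K))), map_mul, hg']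
    have h0 : ∀ a : A, a ≠ 0 → polyToRatFuncHom A K (Polynomial.C a) ≠ 0 := fun a ha =>
      (map_ne_zero_iff _ polyToRatFuncHom_injective).2 (Polynomial.C_ne_zero.2 ha)
    exact mul_ne_zero (h0 b hb0) (mul_ne_zero (h0 c hc0) hq)
  · rw [map_mul, map_mul, hf', hg']
    nth_rw 1 [← RatFunc.num_div_denom q]
    field_simp

variable {Γ : Type*} [AddCommMonoid Γ] [LinearOrder Γ] {𝒜 : Γ → AddSubgroup A} [GradedRing 𝒜]

omit [IsFractionRing A K] in
theorem mem_KRSet_bOp_of_le {f g : Polynomial A} (hg : g ≠ 0)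
    (h : homogContentIdeal 𝒜 f ≤ homogContentIdeal 𝒜 g) {q : RatFunc K}
    (hq : q * polyToRatFuncHom A K g = polyToRatFuncHom A K f) :
    q ∈ KRSet 𝒜 (bOp : Submodule A K → Submodule A K) :=
  ⟨f, g, 1, hg, one_ne_zero, hq,
    (Submodule.map_mono (Ideal.mul_mono_left h)).trans (le_bOp _)⟩

omit [IsFractionRing A K] in
theorem polyToRatFuncHom_mem_KRSet (f : Polynomial A) :
    polyToRatFuncHom A K f ∈ KRSet 𝒜 (bOp : Submodule A K → Submodule A K) :=
  mem_KRSet_bOp_of_le (f := f) one_ne_zero (homogContentIdeal_one (𝒜 := 𝒜) ▸ le_top) (by simp)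

/-- On a valuation overring of the homogeneous Kronecker function ring, the value of a polynomial
is the maximum of the values of the homogeneous components of its coefficients. -/
theorem valuation_polyToRatFuncHom_le_iff {W : ValuationSubring (RatFunc K)}
    (hW : KRSet 𝒜 (bOp : Submodule A K → Submodule A K) ⊆ W) (f : Polynomial A)
    (b : W.ValueGroup) : W.valuation (polyToRatFuncHom A K f) ≤ b ↔
      ∀ c ∈ homogComponents 𝒜 f, W.valuation (polyToRatFuncHom A K (Polynomial.C c)) ≤ b := by
  classical
  constructor
  · intro h c hc
    refine le_trans ?_ h
    by_cases hf : f = 0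
    · obtain ⟨n, γ, rfl⟩ := hc
      simp [hf]
    have hf' : polyToRatFuncHom A K f ≠ 0 :=
      (map_ne_zero_iff _ polyToRatFuncHom_injective).2 hf
    have hmem := (W.valuation_le_one_iff _).2 (hW (mem_KRSet_bOp_of_le hf (homogContentIdeal_C_le hc)
      (div_mul_cancel₀ (polyToRatFuncHom A K (Polynomial.C c)) hf')))
    rwa [map_div₀, div_le_one₀ (zero_lt_iff.2 ((Valuation.ne_zero_iff _).2 hf'))] at hmem
  · intro h
    rw [f.as_sum_support_C_mul_X_pow, map_sum]
    refine Valuation.map_sum_le _ fun n _ => ?_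
    rw [map_mul, map_mul]
    refine (mul_le_of_le_one_right' ((W.valuation_le_one_iff _).2
      (hW (polyToRatFuncHom_mem_KRSet _)))).trans ?_
    rw [← DirectSum.sum_support_decompose 𝒜 (f.coeff n), map_sum, map_sum]
    exact Valuation.map_sum_le _ fun γ _ => h _ ⟨n, γ, rfl⟩

/-- Membership in a valuation overring of the homogeneous Kronecker function ring only depends on
its homogeneous elements. -/
theorem mem_iff_forall_homogComponents {W : ValuationSubring (RatFunc K)}
    (hW : KRSet 𝒜 (bOp : Submodule A K → Submodule A K) ⊆ W) {f g : Polynomial A} (hg : g ≠ 0)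
    {q : RatFunc K} (hq : q * polyToRatFuncHom A K g = polyToRatFuncHom A K f) :
    q ∈ W ↔ ∀ c ∈ homogComponents 𝒜 f \ {0}, ∃ d ∈ homogComponents 𝒜 g \ {0},
      algebraMap K (RatFunc K) (algebraMap A K c / algebraMap A K d) ∈ W := by
  have hg' : polyToRatFuncHom A K g ≠ 0 := (map_ne_zero_iff _ polyToRatFuncHom_injective).2 hg
  have hdiv : ∀ c d : A, d ≠ 0 →
      (algebraMap K (RatFunc K) (algebraMap A K c / algebraMap A K d) ∈ W ↔
        W.valuation (polyToRatFuncHom A K (Polynomial.C c)) ≤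
          W.valuation (polyToRatFuncHom A K (Polynomial.C d))) := fun c d hd => by
    rw [map_div₀, ← polyToRatFuncHom_C, ← polyToRatFuncHom_C, ← W.valuation_le_one_iff, map_div₀,
      div_le_one₀ (zero_lt_iff.2 ((Valuation.ne_zero_iff _).2
        ((map_ne_zero_iff _ polyToRatFuncHom_injective).2 (Polynomial.C_ne_zero.2 hd))))]
  have hqW : q ∈ W ↔ W.valuation (polyToRatFuncHom A K f) ≤
      W.valuation (polyToRatFuncHom A K g) := by
    rw [eq_div_of_mul_eq hg' hq, ← W.valuation_le_one_iff, map_div₀,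
      div_le_one₀ (zero_lt_iff.2 ((Valuation.ne_zero_iff _).2 hg'))]
  rw [hqW, valuation_polyToRatFuncHom_le_iff hW]
  constructor
  · rintro h c ⟨hc, -⟩
    obtain ⟨d, hd, hgd⟩ := exists_mem_homogComponents_eq g _ _
      (valuation_polyToRatFuncHom_le_iff hW g)
    have hd0 : d ≠ 0 := by
      rintro rfl
      rw [map_zero, map_zero, map_zero, Valuation.zero_iff] at hgd
      exact hg' hgd
    exact ⟨d, ⟨hd, hd0⟩, (hdiv c d hd0).2 (hgd ▸ h c hc)⟩
  · intro h c hc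
    by_cases hc0 : c = 0
    · simp [hc0]
    obtain ⟨d, ⟨hd, hd0⟩, hcd⟩ := h c ⟨hc, hc0⟩
    exact ((hdiv c d hd0).1 hcd).trans
      ((valuation_polyToRatFuncHom_le_iff hW g _).1 le_rfl d hd)

end Kronecker

section HomogPart
variable {Γ : Type*} [AddCommMonoid Γ] [LinearOrder Γ]
  {A : Type*} [CommRing A] [IsDomain A]
  {K : Type*} [Field K] [Algebra A K] [IsFractionRing A K]
  (𝒜 : Γ → AddSubgroup A) [GradedRing 𝒜]

/-- The multiplicative monoid of homogeneous elements of `R_H` lying in `W`. -/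
def homogSubmonoid (W : ValuationSubring (RatFunc K)) : Submonoid K where
  carrier := {x : K | IsHomogElem 𝒜 x ∧ algebraMap K (RatFunc K) x ∈ W}
  one_mem' := ⟨by simpa using (isHomog_one (𝒜 := 𝒜)).isHomogElem (K := K), by simp⟩
  mul_mem' hx hy := ⟨hx.1.mul hy.1, by simpa using mul_mem hx.2 hy.2⟩

/-- The subring of `K` of finite sums of homogeneous elements of `R_H` lying in `W`. -/
def homogPart (W : ValuationSubring (RatFunc K)) : Subring K where
  __ := (homogSubmonoid 𝒜 W).subsemiringClosure
  neg_mem' {x} hx := by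
    change x ∈ AddSubmonoid.closure {x : K | IsHomogElem 𝒜 x ∧ algebraMap K (RatFunc K) x ∈ W} at hx
    change -x ∈ AddSubmonoid.closure {x : K | IsHomogElem 𝒜 x ∧ algebraMap K (RatFunc K) x ∈ W}
    induction hx using AddSubmonoid.closure_induction with
    | mem x hx => exact AddSubmonoid.subset_closure ⟨hx.1.neg, by simpa using hx.2⟩
    | zero => simp
    | add x y _ _ hx hy => rw [neg_add]; exact add_mem hx hy

omit [IsFractionRing A K] in
theorem coe_homogPart (W : ValuationSubring (RatFunc K)) :
    (homogPart 𝒜 W : Set K) = (AddSubmonoid.closure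
      {x : K | IsHomogElem 𝒜 x ∧ algebraMap K (RatFunc K) x ∈ W} : AddSubmonoid K) := rfl

variable {𝒜}

omit [IsFractionRing A K] in
theorem mem_homogPart_iff {W : ValuationSubring (RatFunc K)} {x : K} (hx : IsHomogElem 𝒜 x) :
    x ∈ homogPart 𝒜 W ↔ algebraMap K (RatFunc K) x ∈ W := by
  refine ⟨fun h => ?_, fun h => AddSubmonoid.subset_closure ⟨hx, h⟩⟩
  have hle : AddSubmonoid.closure {x : K | IsHomogElem 𝒜 x ∧ algebraMap K (RatFunc K) x ∈ W} ≤
      W.toSubring.toAddSubmonoid.comap (algebraMap K (RatFunc K)).toAddMonoidHom :=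
    AddSubmonoid.closure_le.2 fun x hx => hx.2
  exact hle h

theorem isGrValOverring_homogPart {W : ValuationSubring (RatFunc K)}
    (hW : KRSet 𝒜 (bOp : Submodule A K → Submodule A K) ⊆ W) :
    IsGrValOverring 𝒜 (homogPart 𝒜 W) := by
  refine ⟨⟨?_, fun x hx => ?_, fun x hx => ?_⟩, fun x hx => ?_⟩
  · refine algebraMap_mem_of_isHomog_mem (𝒜 := 𝒜) (homogPart 𝒜 W).toAddSubmonoid fun a ha => ?_
    refine (mem_homogPart_iff ha.isHomogElem).2 ?_
    rw [← polyToRatFuncHom_C]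
    exact hW (polyToRatFuncHom_mem_KRSet _)
  · change x ∈ AddSubmonoid.closure {x : K | IsHomogElem 𝒜 x ∧ algebraMap K (RatFunc K) x ∈ W} at hx
    induction hx using AddSubmonoid.closure_induction with
    | mem x hx =>
      obtain ⟨a, s, -, hs, h⟩ := hx.1
      exact ⟨a, s, hs, h⟩
    | zero => exact ⟨0, 1, isHomog_one, by simp⟩
    | add x y _ _ hx hy => exact hx.add hy
  · have hle : AddSubmonoid.closure {x : K | IsHomogElem 𝒜 x ∧ algebraMap K (RatFunc K) x ∈ W} ≤
        (AddSubgroup.closure {x : K | x ∈ homogPart 𝒜 W ∧ IsHomogElem 𝒜 x}).toAddSubmonoid :=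
      AddSubmonoid.closure_le.2 fun x hx =>
        AddSubgroup.subset_closure ⟨(mem_homogPart_iff hx.1).2 hx.2, hx.1⟩
    exact hle hx
  · rw [mem_homogPart_iff hx, mem_homogPart_iff hx.inv, map_inv₀]
    exact W.mem_or_inv_mem _

omit [AddCommMonoid Γ] [LinearOrder Γ] [IsDomain A] [IsFractionRing A K] [GradedRing 𝒜] in
theorem IsGrValOverring.eq_of_forall_isHomogElem {V V' : Subring K} (hV : IsGrValOverring 𝒜 V)
    (hV' : IsGrValOverring 𝒜 V') (h : ∀ x, IsHomogElem 𝒜 x → (x ∈ V ↔ x ∈ V')) : V = V' := by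
  have key : ∀ U U' : Subring K, IsGrValOverring 𝒜 U →
      (∀ x, IsHomogElem 𝒜 x → x ∈ U → x ∈ U') → U ≤ U' := fun U U' hU h x hx =>
    (AddSubgroup.closure_le U'.toAddSubgroup).2 (fun y hy => h y hy.2 hy.1) (hU.1.2.2 x hx)
  exact le_antisymm (key V V' hV fun x hx => (h x hx).1) (key V' V hV' fun x hx => (h x hx).2)

end HomogPart

section Center
variable {Γ : Type*} [AddCommMonoid Γ] [LinearOrder Γ]
  {A : Type*} [CommRing A] [IsDomain A]
  {K : Type*} [Field K] [Algebra A K] [IsFractionRing A K]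
  {𝒜 : Γ → AddSubgroup A} [GradedRing 𝒜]

variable (𝒜) in
/-- The homogeneous elements `c` of `A` such that `c / s` is a nonunit of `V`. -/
def homogNonunitNumerators (V : Subring K) (s : A) : Set A :=
  {c : A | IsHomog 𝒜 c ∧ algebraMap A K c / algebraMap A K s ∈ V ∧
    algebraMap A K s / algebraMap A K c ∉ V}

omit [AddCommMonoid Γ] [LinearOrder Γ] [IsDomain A] [GradedRing 𝒜] in
theorem add_mem_homogNonunitNumerators {V : Subring K} (hV : IsGrValOverring 𝒜 V) {s a b : A}
    {γ : Γ} (ha : a ∈ 𝒜 γ) (hb : b ∈ 𝒜 γ) (has : a ∈ homogNonunitNumerators 𝒜 V s)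
    (hbs : b ∈ homogNonunitNumerators 𝒜 V s) (hab : a + b ≠ 0) :
    a + b ∈ homogNonunitNumerators 𝒜 V s := by
  wlog h : algebraMap A K a / algebraMap A K b ∈ V generalizing a b
  · rw [add_comm a b] at hab ⊢
    refine this hb ha hbs has hab ?_
    have := (hV.2 _ (has.1.isHomogElem_div (K := K) hbs.1)).resolve_left h
    rwa [inv_div] at this
  have hb0 := hbs.1.algebraMap_ne_zero K
  have hsum : IsHomog 𝒜 (a + b) := ⟨hab, γ, add_mem ha hb⟩
  have hsum0 := hsum.algebraMap_ne_zero K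
  have hsb : algebraMap A K (a + b) / algebraMap A K b ∈ V := by
    rw [map_add, add_div, div_self hb0]
    exact add_mem h V.one_mem
  refine ⟨hsum, ?_, fun hinv => hbs.2.2 ?_⟩
  · rw [← div_mul_div_cancel₀ hb0]
    exact mul_mem hsb hbs.2.1
  · rw [← div_mul_div_cancel₀ hsum0]
    exact mul_mem hinv hsb

omit [IsDomain A] in
theorem decompose_mem_homogNonunitNumerators {V : Subring K} (hV : IsGrValOverring 𝒜 V) {s a : A}
    (ha : a ∈ AddSubmonoid.closure (homogNonunitNumerators 𝒜 V s)) (γ : Γ) :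
    (DirectSum.decompose 𝒜 a γ : A) ≠ 0 →
      (DirectSum.decompose 𝒜 a γ : A) ∈ homogNonunitNumerators 𝒜 V s := by
  induction ha using AddSubmonoid.closure_induction with
  | mem a ha =>
    intro h0
    obtain ⟨δ, hδ⟩ := ha.1.2
    by_cases h : δ = γ
    · subst h
      rwa [DirectSum.decompose_of_mem_same 𝒜 hδ]
    · exact absurd (DirectSum.decompose_of_mem_ne 𝒜 hδ h) h0
  | zero => simp
  | add a b _ _ iha ihb =>
    rw [DirectSum.decompose_add, DirectSum.add_apply, AddSubgroup.coe_add]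
    intro h0
    by_cases ha0 : (DirectSum.decompose 𝒜 a γ : A) = 0
    · rw [ha0, zero_add] at h0 ⊢
      exact ihb h0
    by_cases hb0 : (DirectSum.decompose 𝒜 b γ : A) = 0
    · rw [hb0, add_zero] at h0 ⊢
      exact iha h0
    exact add_mem_homogNonunitNumerators hV (SetLike.coe_mem _) (SetLike.coe_mem _) (iha ha0)
      (ihb hb0) h0

theorem mul_mem_closure_homogNonunitNumerators {V : Subring K} {s t a : A} (ht : IsHomog 𝒜 t)
    (ha : a ∈ AddSubmonoid.closure (homogNonunitNumerators 𝒜 V s)) :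
    a * t ∈ AddSubmonoid.closure (homogNonunitNumerators 𝒜 V (s * t)) := by
  have ht0 := ht.algebraMap_ne_zero K
  induction ha using AddSubmonoid.closure_induction with
  | mem a ha =>
    refine AddSubmonoid.subset_closure ⟨ha.1.mul ht, ?_, ?_⟩
    · rw [map_mul, map_mul, mul_div_mul_right _ _ ht0]
      exact ha.2.1
    · rw [map_mul, map_mul, mul_div_mul_right _ _ ht0]
      exact ha.2.2
  | zero => simp
  | add a b _ _ iha ihb => rw [add_mul]; exact add_mem iha ihb

/-- The homogeneous nonunits of a gr-valuation overring do not sum up to `1`. -/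
theorem one_notMem_closure_homog_nonunits {V : Subring K} (hV : IsGrValOverring 𝒜 V) :
    (1 : K) ∉ AddSubmonoid.closure {x : K | IsHomogElem 𝒜 x ∧ x ∈ V ∧ x⁻¹ ∉ V} := by
  have key : ∀ x ∈ AddSubmonoid.closure {x : K | IsHomogElem 𝒜 x ∧ x ∈ V ∧ x⁻¹ ∉ V},
      ∃ s, IsHomog 𝒜 s ∧ ∃ a ∈ AddSubmonoid.closure (homogNonunitNumerators 𝒜 V s),
        x * algebraMap A K s = algebraMap A K a := by
    intro x hx
    induction hx using AddSubmonoid.closure_induction with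
    | mem x hx =>
      obtain ⟨hx, hxV, hxV'⟩ := hx
      obtain ⟨a, s, ha, hs, rfl⟩ := isHomogElem_iff_eq_div.1 hx
      rw [inv_div] at hxV'
      exact ⟨s, hs, a, AddSubmonoid.subset_closure ⟨ha, hxV, hxV'⟩,
        div_mul_cancel₀ _ (hs.algebraMap_ne_zero K)⟩
    | zero => exact ⟨1, isHomog_one, 0, zero_mem _, by simp⟩
    | add x y _ _ hx hy =>
      obtain ⟨s, hs, a, ha, hsa⟩ := hx
      obtain ⟨t, ht, b, hb, htb⟩ := hy
      refine ⟨s * t, hs.mul ht, a * t + b * s,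
        add_mem (mul_mem_closure_homogNonunitNumerators ht ha) ?_, ?_⟩
      · rw [mul_comm s t]
        exact mul_mem_closure_homogNonunitNumerators hs hb
      · rw [map_add, map_mul, map_mul, map_mul, ← hsa, ← htb]
        ring
  intro h
  obtain ⟨s, hs, a, ha, hsa⟩ := key 1 h
  rw [one_mul] at hsa
  obtain rfl := IsFractionRing.injective A K hsa
  obtain ⟨γ, hγ⟩ := hs.2
  have hmem := decompose_mem_homogNonunitNumerators hV ha γ
  rw [DirectSum.decompose_of_mem_same 𝒜 hγ] at hmem
  exact (hmem hs.1).2.2 (by rw [div_self (hs.algebraMap_ne_zero K)]; exact V.one_mem)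

/-- Every gr-valuation overring is dominated by a valuation ring of `K` with the same homogeneous
elements. -/
theorem IsGrValOverring.exists_valuationSubring {V : Subring K} (hV : IsGrValOverring 𝒜 V) :
    ∃ U : ValuationSubring K, V ≤ U.toSubring ∧ ∀ x, IsHomogElem 𝒜 x → (x ∈ U ↔ x ∈ V) := by
  set I : Ideal V := Ideal.span {x : V | IsHomogElem 𝒜 (x : K) ∧ (x : K)⁻¹ ∉ V} with hI
  have hsub : ∀ x ∈ I, (x : K) ∈
      AddSubmonoid.closure {x : K | IsHomogElem 𝒜 x ∧ x ∈ V ∧ x⁻¹ ∉ V} := by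
    intro x hx
    rw [hI] at hx
    induction hx using Submodule.span_induction with
    | mem x hx => exact AddSubmonoid.subset_closure ⟨hx.1, x.2, hx.2⟩
    | zero => exact zero_mem _
    | add x y _ _ hx hy => exact add_mem hx hy
    | smul v x _ hx =>
      have hneg : ∀ y ∈ AddSubmonoid.closure {x : K | IsHomogElem 𝒜 x ∧ x ∈ V ∧ x⁻¹ ∉ V},
          -y ∈ AddSubmonoid.closure {x : K | IsHomogElem 𝒜 x ∧ x ∈ V ∧ x⁻¹ ∉ V} := by
        intro y hy
        induction hy using AddSubmonoid.closure_induction with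
        | mem y hy =>
          refine AddSubmonoid.subset_closure ⟨hy.1.neg, neg_mem hy.2.1, ?_⟩
          rw [inv_neg, neg_mem_iff]
          exact hy.2.2
        | zero => simp
        | add y z _ _ hy hz => rw [neg_add]; exact add_mem hy hz
      have hv := hV.1.2.2 v v.2
      rw [smul_eq_mul, Subring.coe_mul]
      generalize (v : K) = u at hv
      generalize (x : K) = z at hx
      induction hv using AddSubgroup.closure_induction with
      | mem u hu =>
        induction hx using AddSubmonoid.closure_induction with
        | mem y hy =>
          refine AddSubmonoid.subset_closure ⟨hu.2.mul hy.1, mul_mem hu.1 hy.2.1, fun h => hy.2.2 ?_⟩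
          have := mul_mem hu.1 h
          rwa [mul_inv, mul_inv_cancel_left₀ hu.2.ne_zero] at this
        | zero => simp
        | add y z _ _ hy hz => rw [mul_add]; exact add_mem hy hz
      | zero => simp
      | add u t _ _ hu ht => rw [add_mul]; exact add_mem hu ht
      | neg u _ hu => rw [neg_mul]; exact hneg _ hu
  have hI' : I ≠ ⊤ := fun h =>
    one_notMem_closure_homog_nonunits hV (hsub 1 ((Ideal.eq_top_iff_one I).1 h))
  obtain ⟨U, hVU, hIU⟩ := I.image_subset_nonunits_valuationSubring hI'
  refine ⟨U, hVU, fun x hx => ⟨fun hxU => ?_, fun hxV => hVU hxV⟩⟩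
  by_contra hxV
  have hinv := (hV.2 x hx).resolve_left hxV
  have hnon : x⁻¹ ∈ U.nonunits :=
    hIU ⟨⟨x⁻¹, hinv⟩, Ideal.subset_span ⟨hx.inv, by rwa [inv_inv]⟩, rfl⟩
  rw [ValuationSubring.mem_nonunits_iff, map_inv₀] at hnon
  rw [← U.valuation_le_one_iff] at hxU
  exact hnon.not_ge (one_le_inv_iff₀.2 ⟨zero_lt_iff.2 ((Valuation.ne_zero_iff _).2 hx.ne_zero), hxU⟩)

end Center

section GradedGauss
variable {Γ : Type*} [AddCommMonoid Γ] [LinearOrder Γ]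
  {A : Type*} [CommRing A] (𝒜 : Γ → AddSubgroup A) [GradedRing 𝒜]

/-- The coaction `a ↦ ∑ γ, a_γ T^γ` of a graded ring. -/
noncomputable def gradedCoaction : A →+* AddMonoidAlgebra A Γ :=
  (DirectSum.toSemiring (fun γ => (AddMonoidAlgebra.singleAddHom γ).comp (𝒜 γ).subtype)
    (by simp [AddMonoidAlgebra.one_def])
    (fun a b => by simp [AddMonoidAlgebra.single_mul_single])).comp
      (DirectSum.decomposeRingEquiv 𝒜).toRingHom

theorem coeff_gradedCoaction (a : A) (γ : Γ) :
    (gradedCoaction 𝒜 a).coeff γ = DirectSum.decompose 𝒜 a γ := by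
  classical
  induction a using DirectSum.Decomposition.inductionOn 𝒜 with
  | zero => simp
  | @homogeneous δ a =>
    have ha : DirectSum.decomposeRingEquiv 𝒜 (a : A) = DirectSum.of (fun i => 𝒜 i) δ a :=
      DirectSum.decompose_coe 𝒜 a
    have hc : gradedCoaction 𝒜 (a : A) = AddMonoidAlgebra.single δ (a : A) := by
      simp [gradedCoaction, ha]
    rw [hc, DirectSum.decompose_coe, DirectSum.coe_of_apply]
    by_cases h : δ = γ <;> simp [h]
  | add a b ha hb => simp [ha, hb]

variable [CovariantClass Γ Γ (· + ·) (· < ·)] {Γ₀ : Type*} [LinearOrderedCommGroupWithZero Γ₀]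

/-- The extension of a valuation on a graded ring to polynomials by the maximum over the
homogeneous components of the coefficients. -/
noncomputable def gradedGaussValuation (v : Valuation A Γ₀) : Valuation (Polynomial A) Γ₀ :=
  haveI := uniqueSums_of_covariantClass_lt Γ
  (gaussValuation ((gaussValuation v).comap (gradedCoaction 𝒜))).comap
    (Polynomial.toFinsuppIso A).toRingHom

theorem gradedGaussValuation_le_iff (v : Valuation A Γ₀) (f : Polynomial A) (b : Γ₀) :
    gradedGaussValuation 𝒜 v f ≤ b ↔ ∀ c ∈ homogComponents 𝒜 f, v c ≤ b := by
  have := uniqueSums_of_covariantClass_lt Γ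
  change gaussValue _ _ ≤ b ↔ _
  rw [gaussValue_le_iff]
  constructor
  · rintro h _ ⟨n, γ, rfl⟩
    rw [← coeff_gradedCoaction]
    exact (gaussValue_le_iff v _ b).1 (h n) γ
  · intro h n
    refine (gaussValue_le_iff v _ b).2 fun γ => ?_
    rw [coeff_gradedCoaction]
    exact h _ ⟨n, γ, rfl⟩

theorem gradedGaussValuation_C (v : Valuation A Γ₀) {a : A} (ha : IsHomog 𝒜 a) :
    gradedGaussValuation 𝒜 v (Polynomial.C a) = v a := by
  obtain ⟨γ, hγ⟩ := ha.2
  refine le_antisymm ((gradedGaussValuation_le_iff 𝒜 v _ _).2 fun c hc => ?_)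
    ((gradedGaussValuation_le_iff 𝒜 v _ _).1 le_rfl a (mem_homogComponents_C hγ))
  rcases eq_zero_or_eq_of_mem_homogComponents_C hγ hc with rfl | rfl <;> simp

theorem exists_homogComponents_eq_gradedGaussValuation (v : Valuation A Γ₀) (f : Polynomial A) :
    ∃ c ∈ homogComponents 𝒜 f, gradedGaussValuation 𝒜 v f = v c :=
  exists_mem_homogComponents_eq f v _ (gradedGaussValuation_le_iff 𝒜 v f)

theorem gradedGaussValuation_ne_zero {v : Valuation A Γ₀} (hv : ∀ a, a ≠ 0 → v a ≠ 0)
    {f : Polynomial A} (hf : f ≠ 0) : gradedGaussValuation 𝒜 v f ≠ 0 := by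
  classical
  intro h
  apply hf
  ext n
  rw [← DirectSum.sum_support_decompose 𝒜 (f.coeff n), Polynomial.coeff_zero]
  refine Finset.sum_eq_zero fun γ _ => ?_
  by_contra hc
  exact hv _ hc (le_antisymm ((gradedGaussValuation_le_iff 𝒜 v f 0).1 h.le _ ⟨n, γ, rfl⟩) zero_le)

theorem le_gradedGaussValuation_of_mem {v : Valuation A Γ₀} (hv : ∀ a, v a ≤ 1)
    {f : Polynomial A} {a : A} (ha : a ∈ homogContentIdeal 𝒜 f) :
    v a ≤ gradedGaussValuation 𝒜 v f := by
  rw [homogContentIdeal_eq_span] at ha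
  induction ha using Submodule.span_induction with
  | mem a ha => exact (gradedGaussValuation_le_iff 𝒜 v f _).1 le_rfl a ha
  | zero => simp
  | add a b _ _ ha hb => exact (v.map_add a b).trans (max_le ha hb)
  | smul r a _ ha =>
    rw [smul_eq_mul, map_mul]
    exact (mul_le_of_le_one_left' (hv r)).trans ha

end GradedGauss

section Surjectivity
variable {Γ : Type*} [AddCommMonoid Γ] [LinearOrder Γ] [CovariantClass Γ Γ (· + ·) (· < ·)]
  {A : Type*} [CommRing A] [IsDomain A]
  {K : Type*} [Field K] [Algebra A K] [IsFractionRing A K]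
  {𝒜 : Γ → AddSubgroup A} [GradedRing 𝒜]

/-- A valuation on `A[X]` with zero support extends to `K(X)`. -/
theorem exists_valuation_ratFunc {Γ₀ : Type*} [LinearOrderedCommGroupWithZero Γ₀]
    (w : Valuation (Polynomial A) Γ₀) (hw : ∀ f, f ≠ 0 → w f ≠ 0) :
    ∃ u : Valuation (RatFunc K) Γ₀, ∀ f, u (polyToRatFuncHom A K f) = w f := by
  let : Algebra (Polynomial A) (RatFunc K) := (polyToRatFuncHom A K).toAlgebra
  have : FaithfulSMul (Polynomial A) (RatFunc K) :=
    (faithfulSMul_iff_algebraMap_injective _ _).2 polyToRatFuncHom_injective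
  have : IsFractionRing (Polynomial A) (RatFunc K) := IsFractionRing.of_field _ _ fun q => by
    obtain ⟨f, g, hg, h⟩ := exists_mul_polyToRatFuncHom_eq (A := A) q
    exact ⟨f, g, eq_div_of_mul_eq ((map_ne_zero_iff _ polyToRatFuncHom_injective).2 hg) h⟩
  have hS : nonZeroDivisors (Polynomial A) ≤ w.supp.primeCompl := fun f hf =>
    hw f (nonZeroDivisors.ne_zero hf)
  exact ⟨w.extendToLocalization hS (RatFunc K), w.extendToLocalization_apply_map_apply hS _⟩

omit [IsDomain A] [IsFractionRing A K] in
theorem valuation_mul_le_of_mem_bOp {U : ValuationSubring K} (hU : ∀ a : A, algebraMap A K a ∈ U)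
    (g h : Polynomial A) {x : K}
    (hx : x ∈ bOp (idealToK (K := K) (homogContentIdeal 𝒜 g * homogContentIdeal 𝒜 h))) :
    U.valuation x ≤ gradedGaussValuation 𝒜 (U.valuation.comap (algebraMap A K)) g *
      gradedGaussValuation 𝒜 (U.valuation.comap (algebraMap A K)) h := by
  have hU' : ∀ a : A, U.valuation.comap (algebraMap A K) a ≤ 1 := fun a =>
    (U.valuation_le_one_iff _).2 (hU a)
  have hx' : x ∈ mulSet (idealToK (K := K) (homogContentIdeal 𝒜 g * homogContentIdeal 𝒜 h))
      (U : Set K) := (Submodule.mem_iInf _).1 ((Submodule.mem_iInf _).1 hx U) hU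
  clear hx
  rw [mulSet] at hx'
  induction hx' using Submodule.span_induction with
  | mem x hx =>
    obtain ⟨_, ⟨e, he, rfl⟩, v, hv, rfl⟩ := hx
    rw [map_mul]
    refine (mul_le_of_le_one_right' ((U.valuation_le_one_iff v).2 hv)).trans ?_
    change U.valuation.comap (algebraMap A K) e ≤ _
    refine Submodule.mul_induction_on he (fun a ha b hb => ?_) fun a b ha hb =>
      (Valuation.map_add _ a b).trans (max_le ha hb)
    rw [map_mul]
    exact mul_le_mul' (le_gradedGaussValuation_of_mem 𝒜 hU' ha)
      (le_gradedGaussValuation_of_mem 𝒜 hU' hb)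
  | zero => simp
  | add x y _ _ hx hy => exact (Valuation.map_add _ x y).trans (max_le hx hy)
  | smul a x _ hx =>
    rw [Algebra.smul_def, map_mul]
    exact (mul_le_of_le_one_left' (hU' a)).trans hx

theorem exists_homogPart_eq {V : Subring K} (hV : IsGrValOverring 𝒜 V) :
    ∃ W : ValuationSubring (RatFunc K),
      KRSet 𝒜 (bOp : Submodule A K → Submodule A K) ⊆ W ∧ homogPart 𝒜 W = V := by
  obtain ⟨U, hVU, hU⟩ := hV.exists_valuationSubring
  have hAU : ∀ a : A, algebraMap A K a ∈ U := fun a => hVU (hV.1.1 a)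
  set v := U.valuation.comap (algebraMap A K) with hv
  have hv0 : ∀ a, a ≠ 0 → v a ≠ 0 := fun a ha => (Valuation.ne_zero_iff U.valuation).2
    ((map_ne_zero_iff _ (IsFractionRing.injective A K)).2 ha)
  obtain ⟨u, hu⟩ := exists_valuation_ratFunc (K := K) (gradedGaussValuation 𝒜 v)
    fun f => gradedGaussValuation_ne_zero 𝒜 hv0
  have hKR : KRSet 𝒜 (bOp : Submodule A K → Submodule A K) ⊆ u.valuationSubring := by
    rintro q ⟨f, g, h, hg, hh, hq, hle⟩
    rw [← polyToRatFuncHom_apply, ← polyToRatFuncHom_apply] at hq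
    have hg0 := gradedGaussValuation_ne_zero 𝒜 hv0 hg
    have hh0 := gradedGaussValuation_ne_zero 𝒜 hv0 hh
    rw [SetLike.mem_coe, Valuation.mem_valuationSubring_iff,
      eq_div_of_mul_eq ((map_ne_zero_iff _ polyToRatFuncHom_injective).2 hg) hq, map_div₀, hu, hu,
      div_le_one₀ (zero_lt_iff.2 hg0)]
    obtain ⟨c, hc, hfc⟩ := exists_homogComponents_eq_gradedGaussValuation 𝒜 v f
    obtain ⟨d, hd, hhd⟩ := exists_homogComponents_eq_gradedGaussValuation 𝒜 v h
    have hcd := valuation_mul_le_of_mem_bOp hAU g h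
      (hle ⟨c * d, Ideal.mul_mem_mul (Ideal.subset_span hc) (Ideal.subset_span hd), rfl⟩)
    change v (c * d) ≤ gradedGaussValuation 𝒜 v g * gradedGaussValuation 𝒜 v h at hcd
    rw [map_mul, ← hfc, ← hhd] at hcd
    exact le_of_mul_le_mul_right hcd (zero_lt_iff.2 hh0)
  refine ⟨u.valuationSubring, hKR,
    (isGrValOverring_homogPart hKR).eq_of_forall_isHomogElem hV fun x hx => ?_⟩
  rw [mem_homogPart_iff hx, ← hU x hx, Valuation.mem_valuationSubring_iff,
    ← U.valuation_le_one_iff]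
  obtain ⟨a, s, ha, hs, rfl⟩ := isHomogElem_iff_eq_div.1 hx
  rw [map_div₀, map_div₀, map_div₀, ← polyToRatFuncHom_C, ← polyToRatFuncHom_C, hu, hu,
    gradedGaussValuation_C 𝒜 v ha, gradedGaussValuation_C 𝒜 v hs]
  rfl

end Surjectivity

section ZarSpaces
variable {Γ : Type*} [AddCommMonoid Γ] [LinearOrder Γ]
  [CovariantClass Γ Γ (· + ·) (· < ·)] [Nontrivial Γ]
  {A : Type*} [CommRing A] [IsDomain A]
  (K : Type*) [Field K] [Algebra A K] [IsFractionRing A K]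
  (𝒜 : Γ → AddSubgroup A) [GradedRing 𝒜]

/-- The map `W ↦ ⊕ (W ∩ (R_H)_α)` from `Zar(KR(R,b))` to `Zar_h(R)`. -/
def zarKRbToZarH (W : ZarKRb K 𝒜) : ZarH K 𝒜 :=
  ⟨homogPart 𝒜 W.1, isGrValOverring_homogPart W.2⟩

variable {K 𝒜} in
omit [CovariantClass Γ Γ (· + ·) (· < ·)] [Nontrivial Γ] in
theorem mem_iff_zarKRbToZarH (W : ZarKRb K 𝒜) {f g : Polynomial A} (hg : g ≠ 0)
    {q : RatFunc K} (hq : q * polyToRatFuncHom A K g = polyToRatFuncHom A K f) :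
    q ∈ W.1 ↔ ∀ c ∈ homogComponents 𝒜 f \ {0}, ∃ d ∈ homogComponents 𝒜 g \ {0},
      algebraMap A K c / algebraMap A K d ∈ (zarKRbToZarH K 𝒜 W).1 := by
  rw [mem_iff_forall_homogComponents W.2 hg hq]
  refine forall₂_congr fun c hc => exists_congr fun d => and_congr_right fun hd => ?_
  exact (mem_homogPart_iff ((isHomog_of_mem_homogComponents hc.1 hc.2).isHomogElem_div
    (isHomog_of_mem_homogComponents hd.1 hd.2))).symm

omit [Nontrivial Γ] in
theorem zarKRbToZarH_bijective : Function.Bijective (zarKRbToZarH K 𝒜) := by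
  refine ⟨fun W W' h => Subtype.ext (ValuationSubring.ext _ _ fun q => ?_), fun V => ?_⟩
  · obtain ⟨f, g, hg, hq⟩ := exists_mul_polyToRatFuncHom_eq (A := A) q
    rw [mem_iff_zarKRbToZarH W hg hq, mem_iff_zarKRbToZarH W' hg hq, h]
  · obtain ⟨W, hW, h⟩ := exists_homogPart_eq V.2
    exact ⟨⟨W, hW⟩, Subtype.ext h⟩

omit [CovariantClass Γ Γ (· + ·) (· < ·)] [Nontrivial Γ] in
theorem isInducing_zarKRbToZarH : Topology.IsInducing (zarKRbToZarH K 𝒜) := by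
  refine ⟨le_antisymm ?_ ?_⟩
  · refine continuous_iff_le_induced.1 (continuous_generateFrom_iff.2 ?_)
    rintro _ ⟨u, hu, rfl⟩
    refine TopologicalSpace.isOpen_generateFrom_of_mem ⟨algebraMap K (RatFunc K) u, ?_⟩
    ext W
    exact mem_homogPart_iff hu
  · refine le_generateFrom ?_
    rintro _ ⟨q, rfl⟩
    obtain ⟨f, g, hg, hq⟩ := exists_mul_polyToRatFuncHom_eq (A := A) q
    refine ⟨⋂ c ∈ homogComponents 𝒜 f \ {0}, ⋃ d ∈ homogComponents 𝒜 g \ {0},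
      {V : ZarH K 𝒜 | algebraMap A K c / algebraMap A K d ∈ V.1}, ?_, ?_⟩
    · refine ((finite_homogComponents f).subset Set.sdiff_subset).isOpen_biInter fun c hc =>
        isOpen_biUnion fun d hd => TopologicalSpace.isOpen_generateFrom_of_mem ⟨_, ?_, rfl⟩
      exact (isHomog_of_mem_homogComponents hc.1 hc.2).isHomogElem_div
        (isHomog_of_mem_homogComponents hd.1 hd.2)
    · ext W
      rw [Set.mem_ofPred_eq, mem_iff_zarKRbToZarH W hg hq]
      simp

/-- The canonical bijection `φ : Zar(KR(R,b)) → Zar_h(R)`,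
`W ↦ ⊕_{α∈⟨Γ⟩}(W ∩ (R_H)_α)` (the set of finite sums of homogeneous elements of `R_H`
lying in `W`), is a homeomorphism for the Zariski topologies. -/
theorem zarKRb_homeomorph_zarH :
    ∃ φ : ZarKRb K 𝒜 ≃ₜ ZarH K 𝒜,
      ∀ W : ZarKRb K 𝒜, ((φ W).1 : Set K) = (AddSubmonoid.closure
        {x : K | IsHomogElem 𝒜 x ∧ algebraMap K (RatFunc K) x ∈ W.1} : AddSubmonoid K) := by
  exact ⟨(Equiv.ofBijective _ (zarKRbToZarH_bijective K 𝒜)).toHomeomorphOfIsInducing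
    (isInducing_zarKRbToZarH K 𝒜), fun W => coe_homogPart 𝒜 W.1⟩

end ZarSpaces
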